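/- The Alexandroff double of the Cantor set is a uniform Eberlein compact space. Concretely, with C ⊆ [0,1] the Cantor set and Γ = C ∪ {2}, the subspace {f_{x,i} : x ∈ C, i ∈ {0,1}} of the product [0,1]^Γ, where f_{x,i}(2) = x, f_{x,i}(γ) = 0 for γ ∈ C with γ ≠ x, f_{x,1}(x) = 1 and f_{x,0}(x) = 0, is homeomorphic to the Alexandroff double of C, and this space is uniform Eberlein compact. -/

import Mathlib

open Filter Topology Set MeasureTheory

noncomputable section

/-- The "ball" `B(Γ) = {x ∈ [-1,1]^Γ : ∑_γ |x_γ| ≤ 1}` inside the product `Γ → ℝ`. -/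
def BGamma (Γ : Type u) : Set (Γ → ℝ) :=
  {x | (∀ γ, |x γ| ≤ 1) ∧ ∑' γ, ENNReal.ofReal |x γ| ≤ 1}

/-- A space is uniform Eberlein compact if it is compact Hausdorff and embeds
homeomorphically into some `B(Γ)` with the product (pointwise) topology. -/
def IsUniformEberlein (K : Type u) [TopologicalSpace K] : Prop :=
  CompactSpace K ∧ T2Space K ∧
    ∃ (Γ : Type u) (f : K → ↥(BGamma Γ)), Topology.IsEmbedding f

/-- The Alexandroff double topology on `C × Bool`: points `(x, true)` are isolated and basic
neighborhoods of `(x, false)` are the sets `(U × {0,1}) \ {(x, true)}` for open `U ∋ x`. -/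
def doubleTopology (C : Type u) [TopologicalSpace C] : TopologicalSpace (C × Bool) where
  IsOpen V := ∀ p ∈ V, p.2 = false →
    ∃ U : Set C, IsOpen U ∧ p.1 ∈ U ∧ (U ×ˢ (Set.univ : Set Bool)) \ {(p.1, true)} ⊆ V
  isOpen_univ := by
    intro p _ _
    exact ⟨Set.univ, isOpen_univ, trivial, by intro q _; trivial⟩
  isOpen_inter := by
    intro V W hV hW p hp hp2
    obtain ⟨U1, hU1, hpU1, hsub1⟩ := hV p hp.1 hp2
    obtain ⟨U2, hU2, hpU2, hsub2⟩ := hW p hp.2 hp2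
    refine ⟨U1 ∩ U2, hU1.inter hU2, ⟨hpU1, hpU2⟩, ?_⟩
    intro q hq
    exact ⟨hsub1 ⟨⟨hq.1.1.1, hq.1.2⟩, hq.2⟩, hsub2 ⟨⟨hq.1.1.2, hq.1.2⟩, hq.2⟩⟩
  isOpen_sUnion := by
    intro S hS p hp hp2
    obtain ⟨V, hVS, hpV⟩ := hp
    obtain ⟨U, hU, hpU, hsub⟩ := hS V hVS p hpV hp2
    exact ⟨U, hU, hpU, fun q hq => ⟨V, hVS, hsub hq⟩⟩

/-- The Alexandroff double of a topological space `C`. -/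
def AlexDouble (C : Type u) [TopologicalSpace C] : Type u := C × Bool

instance (C : Type u) [TopologicalSpace C] : TopologicalSpace (AlexDouble C) :=
  doubleTopology C

/-- The index set `Γ = C ∪ {2}` where `C` is the Cantor set. -/
def cantorGamma : Set ℝ := cantorSet ∪ {2}

/-- The function `f_{x,i} : Γ → [0,1]`: it sends `2 ↦ x`, `γ = x ↦ (1 if i = 1 else 0)`,
and all other `γ ∈ C` to `0`. -/
def doubleFun (x : ℝ) (i : Bool) : ↥cantorGamma → ℝ := fun γ =>
  if (γ : ℝ) = 2 then x else if (γ : ℝ) = x then (if i then 1 else 0) else 0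

/-- The subspace `{f_{x,i} : x ∈ C, i ∈ {0,1}}` of the product `[0,1]^Γ ⊆ ℝ^Γ`. -/
def cantorDouble : Set (↥cantorGamma → ℝ) :=
  {f | ∃ x ∈ cantorSet, ∃ i : Bool, f = doubleFun x i}

theorem AlexDouble.isOpen_iff {C : Type u} [TopologicalSpace C] {V : Set (AlexDouble C)} :
    IsOpen V ↔ ∀ p ∈ V, p.2 = false →
      ∃ U : Set C, IsOpen U ∧ p.1 ∈ U ∧ ∀ q : AlexDouble C, q.1 ∈ U → q ≠ (p.1, true) → q ∈ V := by
  refine forall₃_congr fun p _ _ => exists_congr fun U => and_congr_right fun _ =>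
    and_congr_right fun _ => ⟨fun h q hq hne => h ⟨⟨hq, trivial⟩, hne⟩, fun h q hq => ?_⟩
  exact h q hq.1.1 hq.2

theorem AlexDouble.continuous_fst {C : Type u} [TopologicalSpace C] :
    Continuous (fun p : AlexDouble C => p.1) :=
  continuous_def.2 fun U hU => AlexDouble.isOpen_iff.2 fun _ hp _ => ⟨U, hU, hp, fun _ hq _ => hq⟩

/-- The points `(c, true)` of the Alexandroff double are isolated. -/
theorem AlexDouble.isOpen_singleton_true {C : Type u} [TopologicalSpace C] (c : C) :
    IsOpen ({(c, true)} : Set (AlexDouble C)) := by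
  refine AlexDouble.isOpen_iff.2 fun p hp hp2 => ?_
  rw [mem_singleton_iff.1 hp] at hp2
  exact absurd hp2 (by simp)

theorem AlexDouble.isClopen_singleton_true {C : Type u} [TopologicalSpace C] [T1Space C] (c : C) :
    IsClopen ({(c, true)} : Set (AlexDouble C)) := by
  refine ⟨⟨AlexDouble.isOpen_iff.2 fun p _ _ => ?_⟩, AlexDouble.isOpen_singleton_true c⟩
  by_cases hc : p.1 = c
  · exact ⟨univ, isOpen_univ, trivial, fun q _ hq => hc ▸ hq⟩
  · refine ⟨{c}ᶜ, isOpen_compl_singleton, hc, fun q hq _ hqc => hq ?_⟩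
    rw [mem_singleton_iff.1 hqc]
    rfl

instance AlexDouble.compactSpace {C : Type u} [TopologicalSpace C] [CompactSpace C] :
    CompactSpace (AlexDouble C) := by
  refine ⟨isCompact_iff_ultrafilter_le_nhds.2 fun F _ => ?_⟩
  obtain ⟨x, -, hx⟩ := isCompact_iff_ultrafilter_le_nhds.1 (isCompact_univ (X := C))
    (F.map fun p : AlexDouble C => p.1) (by simp)
  by_cases hF : ({(x, true)} : Set (AlexDouble C)) ∈ F
  · refine ⟨(x, true), trivial, fun s hs => ?_⟩
    exact mem_of_superset hF (singleton_subset_iff.2 (mem_of_mem_nhds (X := AlexDouble C) hs))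
  · refine ⟨(x, false), trivial, fun s hs => ?_⟩
    obtain ⟨V, hVs, hV, hxV⟩ := mem_nhds_iff.1 hs
    obtain ⟨U, hU, hxU, hUV⟩ := AlexDouble.isOpen_iff.1 hV _ hxV rfl
    have hUF : (fun p : AlexDouble C => p.1) ⁻¹' U ∈ F := hx (hU.mem_nhds hxU)
    have hne := Ultrafilter.compl_mem_iff_notMem.2 hF
    exact mem_of_superset (inter_mem hUF hne) fun q hq => hVs (hUV q hq.1 hq.2)

theorem two_notMem_cantorSet : (2 : ℝ) ∉ cantorSet := fun h => by
  have := (cantorSet_subset_unitInterval h).2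
  norm_num at this

theorem doubleFun_two (x : ℝ) (i : Bool) : doubleFun x i ⟨2, Or.inr rfl⟩ = x := by
  simp [doubleFun]

theorem doubleFun_of_mem (x : ℝ) (i : Bool) {c : ℝ} (hc : c ∈ cantorSet) :
    doubleFun x i ⟨c, Or.inl hc⟩ = if c = x then (if i then 1 else 0) else 0 := by
  have : c ≠ 2 := fun h => two_notMem_cantorSet (h ▸ hc)
  simp [doubleFun, this]

/-- The parametrization `(x, i) ↦ f_{x,i}` of the concrete double. -/
def doubleMap (p : AlexDouble ↥cantorSet) : ↥cantorDouble :=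
  ⟨doubleFun p.1 p.2, p.1, p.1.2, p.2, rfl⟩

theorem continuous_doubleMap : Continuous doubleMap := by
  refine Continuous.subtype_mk (continuous_pi fun γ => ?_) _
  obtain ⟨c, hc | rfl⟩ := γ
  · have h : (fun p : AlexDouble ↥cantorSet => doubleFun p.1 p.2 ⟨c, Or.inl hc⟩) =
        ({(⟨c, hc⟩, true)} : Set (AlexDouble ↥cantorSet)).indicator fun _ => (1 : ℝ) := by
      funext p
      have hmem : p ∈ ({(⟨c, hc⟩, true)} : Set (AlexDouble ↥cantorSet)) ↔
          (p.1 : ℝ) = c ∧ p.2 = true :=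
        mem_singleton_iff.trans (Prod.ext_iff.trans (and_congr_left' Subtype.ext_iff))
      rw [doubleFun_of_mem _ _ hc]
      simp only [indicator, hmem, eq_comm (a := c), ite_and]
    rw [h]
    exact continuous_const.indicator fun a ha => by
      rw [(AlexDouble.isClopen_singleton_true _).frontier_eq] at ha
      exact ha.elim
  · simp only [doubleFun_two]
    exact continuous_subtype_val.comp AlexDouble.continuous_fst

theorem bijective_doubleMap : Function.Bijective doubleMap := by
  constructor
  · rintro ⟨⟨x, hx⟩, i⟩ ⟨⟨y, hy⟩, j⟩ h
    have hf : doubleFun x i = doubleFun y j := congrArg Subtype.val h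
    have hxy : x = y := by
      simpa only [doubleFun_two] using congrFun hf ⟨2, Or.inr rfl⟩
    subst hxy
    have hij := congrFun hf ⟨x, Or.inl hx⟩
    rw [doubleFun_of_mem _ _ hx, doubleFun_of_mem _ _ hx] at hij
    cases i <;> cases j <;> first | rfl | simp at hij
  · rintro ⟨_, x, hx, i, rfl⟩
    exact ⟨(⟨x, hx⟩, i), rfl⟩

/-- The Alexandroff double of the Cantor set is homeomorphic to the concrete double. -/
def doubleHomeomorph : AlexDouble ↥cantorSet ≃ₜ ↥cantorDouble :=
  haveI : CompactSpace ↥cantorSet := isCompact_iff_compactSpace.1 isCompact_cantorSet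
  continuous_doubleMap.homeoOfEquivCompactToT2 (f := Equiv.ofBijective _ bijective_doubleMap)

theorem half_mem_BGamma {f : ↥cantorGamma → ℝ} (hf : f ∈ cantorDouble) :
    (fun γ => f γ / 2) ∈ BGamma ↥cantorGamma := by
  obtain ⟨x, hx, i, rfl⟩ := hf
  obtain ⟨hx0, hx1⟩ := cantorSet_subset_unitInterval hx
  have hbound : ∀ γ, |doubleFun x i γ / 2| ≤ 1 / 2 := fun γ => by
    rw [abs_le]
    unfold doubleFun
    split_ifs <;> constructor <;> linarith
  refine ⟨fun γ => (hbound γ).trans (by norm_num), ?_⟩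
  have hne : (⟨2, Or.inr rfl⟩ : ↥cantorGamma) ≠ ⟨x, Or.inl hx⟩ := fun h => by
    have h2 : (2 : ℝ) = x := congrArg Subtype.val h
    exact two_notMem_cantorSet (h2 ▸ hx)
  rw [tsum_eq_sum (s := {⟨2, Or.inr rfl⟩, ⟨x, Or.inl hx⟩}), Finset.sum_pair hne,
    ← ENNReal.ofReal_add (abs_nonneg _) (abs_nonneg _), ENNReal.ofReal_le_one]
  · linarith [hbound ⟨2, Or.inr rfl⟩, hbound ⟨x, Or.inl hx⟩]
  · rintro ⟨c, hc⟩ hcs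
    simp only [Finset.mem_insert, Finset.mem_singleton, not_or] at hcs
    have hc2 : c ≠ 2 := fun h => hcs.1 (Subtype.ext h)
    have hcx : c ≠ x := fun h => hcs.2 (Subtype.ext h)
    simp [doubleFun, hc2, hcx]

theorem isEmbedding_half :
    IsEmbedding fun f : ↥cantorDouble =>
      (⟨fun γ => f.1 γ / 2, half_mem_BGamma f.2⟩ : ↥(BGamma ↥cantorGamma)) := by
  have hscale : IsEmbedding fun f : ↥cantorGamma → ℝ => fun γ => f γ / 2 := by
    refine IsEmbedding.of_leftInverse (f := fun f γ => f γ * 2) (fun f => ?_)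
      (by fun_prop) (by fun_prop)
    funext γ
    simp
  exact (hscale.comp IsEmbedding.subtypeVal).codRestrict _ fun f => half_mem_BGamma f.2

/-- The subspace `{f_{x,i}}` is homeomorphic to the Alexandroff double of the Cantor set,
and it (hence the Alexandroff double of the Cantor set) is uniform Eberlein compact. -/
theorem stmt_10 :
    Nonempty (↥cantorDouble ≃ₜ AlexDouble ↥cantorSet) ∧
    IsUniformEberlein ↥cantorDouble := by
  have : CompactSpace ↥cantorSet := isCompact_iff_compactSpace.1 isCompact_cantorSet
  exact ⟨⟨doubleHomeomorph.symm⟩, doubleHomeomorph.compactSpace, inferInstance,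
    ↥cantorGamma, _, isEmbedding_half⟩
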